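/- Let α, β, γ > 0 be real and t ∈ (0,1). Define the Turánian difference Δ_T(t) = [E_{α,α+β}^{γ+1}(t^α)]² − E_{α,β}^γ(t^α) · E_{α,2α+β}^{γ+2}(t^α). Then Δ_T(t) ≤ (1 / (γ Γ₀ t^α (1 − t^α)^{2γ+1})) · [ 1/Γ₁ + t^α / (Γ₂ (1 − t^α)) ], where Γ_p = inf_{n ∈ ℕ, n ≥ p} Γ(αn + β) for p = 0, 1, 2. -/

import Mathlib

open scoped BigOperators

/-- Pochhammer symbol `(γ)_k = Γ(γ+k)/Γ(γ)`. -/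
noncomputable def poch (γ : ℝ) (k : ℕ) : ℝ := Real.Gamma (γ + k) / Real.Gamma γ

/-- The Prabhakar (three-parameter Mittag-Leffler) function
`E_{α,β}^γ(x) = ∑_{k≥0} (γ)_k x^k / (k! Γ(αk+β))`. -/
noncomputable def prabhakar (α β γ x : ℝ) : ℝ :=
  ∑' k : ℕ, poch γ k * x ^ k / (k.factorial * Real.Gamma (α * k + β))

/-- `Γ_p = inf_{n ∈ ℕ, n ≥ p} Γ(αn + β)`. -/
noncomputable def gammaInf (α β : ℝ) (p : ℕ) : ℝ :=
  ⨅ n : {m : ℕ // p ≤ m}, Real.Gamma (α * (n : ℕ) + β)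

theorem poch_pos {γ : ℝ} (hγ : 0 < γ) (k : ℕ) : 0 < poch γ k :=
  div_pos (Real.Gamma_pos_of_pos (by positivity)) (Real.Gamma_pos_of_pos hγ)

theorem poch_zero {γ : ℝ} (hγ : 0 < γ) : poch γ 0 = 1 := by
  simp [poch, (Real.Gamma_pos_of_pos hγ).ne']

theorem poch_succ {γ : ℝ} (hγ : 0 < γ) (k : ℕ) : poch γ (k + 1) = poch γ k * (γ + k) := by
  have h : Real.Gamma (γ + (k + 1 : ℕ)) = (γ + k) * Real.Gamma (γ + k) := by
    rw [← Real.Gamma_add_one (by positivity)]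
    push_cast
    ring_nf
  rw [poch, poch, h]
  ring

theorem mul_poch_add_one {γ : ℝ} (hγ : 0 < γ) (k : ℕ) :
    γ * poch (γ + 1) k = poch γ (k + 1) := by
  have h : γ + 1 + k = γ + (k + 1 : ℕ) := by push_cast; ring
  rw [poch, poch, Real.Gamma_add_one hγ.ne', h]
  have := (Real.Gamma_pos_of_pos hγ).ne'
  field_simp

theorem poch_eq_ascPochhammer_eval {γ : ℝ} (hγ : 0 < γ) (k : ℕ) :
    poch γ k = (ascPochhammer ℝ k).eval γ := by
  induction k with
  | zero => simp [poch_zero hγ]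
  | succ k ih => rw [poch_succ hγ, ascPochhammer_succ_eval, ih]

theorem choose_add_sub_one_eq_poch_div {γ : ℝ} (hγ : 0 < γ) (k : ℕ) :
    Ring.choose (γ + k - 1) k = poch γ k / k.factorial := by
  have h := Ring.factorial_nsmul_multichoose_eq_ascPochhammer γ k
  rw [Polynomial.ascPochhammer_smeval_eq_eval, ← poch_eq_ascPochhammer_eval hγ, nsmul_eq_mul] at h
  rw [Ring.choose, eq_div_iff (by positivity), ← h, mul_comm]
  congr 2
  ring

theorem hasSum_poch_mul_pow {γ x : ℝ} (hγ : 0 < γ) (hx : 0 < x) (hx1 : x < 1) :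
    HasSum (fun k : ℕ => poch γ k / k.factorial * x ^ k) (1 / (1 - x) ^ γ) := by
  have h := (Real.one_div_one_sub_rpow_hasFPowerSeriesOnBall_zero γ).hasSum (y := x)
    (by simpa [Metric.mem_eball, abs_of_pos hx, ← ofReal_norm] using hx1)
  simpa [FormalMultilinearSeries.ofScalars_apply_eq, mul_comm, choose_add_sub_one_eq_poch_div hγ] using h

theorem half_le_Gamma {y : ℝ} (hy : 0 < y) : 1 / 2 ≤ Real.Gamma y := by
  have one_le : ∀ z : ℝ, 2 ≤ z → 1 ≤ Real.Gamma z := fun z hz => by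
    simpa [Real.Gamma_two] using
      Real.Gamma_strictMonoOn_Ici.monotoneOn (a := 2) (b := z) (by simp) hz hz
  have h1 := Real.Gamma_add_one hy.ne'
  have h2 := Real.Gamma_add_one (s := y + 1) (by positivity)
  have hp := Real.Gamma_pos_of_pos hy
  rcases le_total 2 y with h | h
  · linarith [one_le y h]
  rcases le_total 1 y with h' | h'
  · have := one_le (y + 1) (by linarith)
    nlinarith
  · have := one_le (y + 1 + 1) (by linarith)
    have : (y + 1) * y ≤ 2 := by nlinarith
    nlinarith

theorem gammaInf_pos {α β : ℝ} (hα : 0 < α) (hβ : 0 < β) (p : ℕ) : 0 < gammaInf α β p :=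
  haveI : Nonempty {m : ℕ // p ≤ m} := ⟨⟨p, le_rfl⟩⟩
  lt_of_lt_of_le one_half_pos (le_ciInf fun _ => half_le_Gamma (by positivity))

theorem gammaInf_le {α β : ℝ} (hα : 0 < α) (hβ : 0 < β) {p n : ℕ} (hn : p ≤ n) :
    gammaInf α β p ≤ Real.Gamma (α * n + β) :=
  ciInf_le (f := fun n : {m : ℕ // p ≤ m} => Real.Gamma (α * (n : ℕ) + β))
    ⟨1 / 2, by rintro _ ⟨n, rfl⟩; exact half_le_Gamma (by positivity)⟩ ⟨n, hn⟩

theorem prabhakar_term_pos {α β γ x : ℝ} (hα : 0 < α) (hβ : 0 < β) (hγ : 0 < γ) (hx : 0 < x)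
    (k : ℕ) : 0 < poch γ k * x ^ k / (k.factorial * Real.Gamma (α * k + β)) := by
  have h := poch_pos hγ k
  have hΓ : 0 < Real.Gamma (α * k + β) := Real.Gamma_pos_of_pos (by positivity)
  positivity

theorem prabhakar_term_le {α β γ x : ℝ} (hα : 0 < α) (hβ : 0 < β) (hγ : 0 < γ) (hx : 0 < x)
    (p k : ℕ) :
    poch γ k * x ^ k / (k.factorial * Real.Gamma (α * k + (p * α + β)))
      ≤ poch γ k / k.factorial * x ^ k / gammaInf α β p := by
  have h := poch_pos hγ k
  have hg := gammaInf_pos hα hβ p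
  have hle : gammaInf α β p ≤ Real.Gamma (α * k + (p * α + β)) := by
    have := gammaInf_le hα hβ (Nat.le_add_left p k)
    rwa [show α * (k + p : ℕ) + β = α * k + (p * α + β) by push_cast; ring] at this
  calc poch γ k * x ^ k / (k.factorial * Real.Gamma (α * k + (p * α + β)))
      ≤ poch γ k * x ^ k / (k.factorial * gammaInf α β p) := by gcongr
    _ = poch γ k / k.factorial * x ^ k / gammaInf α β p := by field_simp

theorem hasSum_prabhakar {α β γ x : ℝ} (hα : 0 < α) (hβ : 0 < β) (hγ : 0 < γ) (hx : 0 < x)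
    (hx1 : x < 1) :
    HasSum (fun k : ℕ => poch γ k * x ^ k / (k.factorial * Real.Gamma (α * k + β)))
      (prabhakar α β γ x) := by
  refine (Summable.of_nonneg_of_le (fun k => (prabhakar_term_pos hα hβ hγ hx k).le) (fun k => ?_)
    ((hasSum_poch_mul_pow hγ hx hx1).div_const (gammaInf α β 0)).summable).hasSum
  simpa using prabhakar_term_le hα hβ hγ hx 0 k

theorem prabhakar_pos {α β γ x : ℝ} (hα : 0 < α) (hβ : 0 < β) (hγ : 0 < γ) (hx : 0 < x)
    (hx1 : x < 1) : 0 < prabhakar α β γ x :=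
  (hasSum_prabhakar hα hβ hγ hx hx1).summable.tsum_pos
    (fun k => (prabhakar_term_pos hα hβ hγ hx k).le) 0 (prabhakar_term_pos hα hβ hγ hx 0)

theorem prabhakar_le {α β γ x : ℝ} (hα : 0 < α) (hβ : 0 < β) (hγ : 0 < γ) (hx : 0 < x)
    (hx1 : x < 1) (p : ℕ) :
    prabhakar α (p * α + β) γ x ≤ 1 / (1 - x) ^ γ / gammaInf α β p :=
  hasSum_le (prabhakar_term_le hα hβ hγ hx p) (hasSum_prabhakar hα (by positivity) hγ hx hx1)
    ((hasSum_poch_mul_pow hγ hx hx1).div_const _)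

theorem hasSum_mul_prabhakar_term {α β γ x : ℝ} (hα : 0 < α) (hβ : 0 < β) (hγ : 0 < γ)
    (hx : 0 < x) (hx1 : x < 1) :
    HasSum (fun k : ℕ => k * (poch γ k * x ^ k / (k.factorial * Real.Gamma (α * k + β))))
      (γ * x * prabhakar α (α + β) (γ + 1) x) := by
  rw [← hasSum_nat_add_iff' 1]
  convert! (hasSum_prabhakar (β := α + β) (γ := γ + 1) hα (by positivity) (by positivity)
    hx hx1).mul_left (γ * x) using 1
  · ext k
    rw [← mul_poch_add_one hγ, Nat.factorial_succ,
      show α * (k + 1 : ℕ) + β = α * k + (α + β) by push_cast; ring]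
    push_cast
    field_simp
    ring
  · simp

theorem hasSum_mul_sub_one_mul_prabhakar_term {α β γ x : ℝ} (hα : 0 < α) (hβ : 0 < β)
    (hγ : 0 < γ) (hx : 0 < x) (hx1 : x < 1) :
    HasSum (fun k : ℕ => k * (k - 1 : ℝ) *
        (poch γ k * x ^ k / (k.factorial * Real.Gamma (α * k + β))))
      (γ * (γ + 1) * x ^ 2 * prabhakar α (2 * α + β) (γ + 2) x) := by
  rw [← hasSum_nat_add_iff' 2]
  convert! (hasSum_prabhakar (β := 2 * α + β) (γ := γ + 2) hα (by positivity) (by positivity)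
    hx hx1).mul_left (γ * (γ + 1) * x ^ 2) using 1
  · ext k
    rw [← mul_poch_add_one hγ, ← mul_poch_add_one (by positivity), Nat.factorial_succ,
      Nat.factorial_succ, show α * (k + 2 : ℕ) + β = α * k + (2 * α + β) by push_cast; ring,
      show γ + 1 + 1 = γ + 2 by ring]
    have : (k : ℝ) + 1 + 1 ≠ 0 := by positivity
    push_cast
    rw [show (k : ℝ) + 2 - 1 = k + 1 by ring, show (k : ℝ) + 2 = k + 1 + 1 by ring]
    field_simp
    ring
  · simp [Finset.sum_range_succ]

/-- Cauchy–Schwarz inequality for the first two moments of a nonnegative sequence. -/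
theorem sq_le_mul_of_hasSum_moments {w : ℕ → ℝ} {s₀ s₁ s₂ : ℝ} (hw : ∀ k, 0 ≤ w k)
    (h₀ : HasSum w s₀) (h₁ : HasSum (fun k : ℕ => k * w k) s₁)
    (h₂ : HasSum (fun k : ℕ => k * (k - 1 : ℝ) * w k) s₂) (hs₀ : 0 < s₀) :
    s₁ ^ 2 ≤ s₀ * (s₂ + s₁) := by
  have h := ((h₂.add h₁).mul_left (s₀ ^ 2)).add
    ((h₁.mul_left (-(2 * s₀ * s₁))).add (h₀.mul_left (s₁ ^ 2)))
  have := h.nonneg fun k => by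
    have := mul_nonneg (sq_nonneg (s₀ * k - s₁)) (hw k)
    linarith
  have : 0 ≤ s₀ * (s₀ * (s₂ + s₁) - s₁ ^ 2) := by linarith
  linarith [nonneg_of_mul_nonneg_right this hs₀]

theorem turanian_difference_le {α β γ x : ℝ} (hα : 0 < α) (hβ : 0 < β) (hγ : 0 < γ)
    (hx : 0 < x) (hx1 : x < 1) :
    prabhakar α (α + β) (γ + 1) x ^ 2 - prabhakar α β γ x * prabhakar α (2 * α + β) (γ + 2) x
      ≤ prabhakar α β γ x / (γ * x) *
        (prabhakar α (α + β) (γ + 1) x + x * prabhakar α (2 * α + β) (γ + 2) x) := by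
  have h := sq_le_mul_of_hasSum_moments (fun k => (prabhakar_term_pos hα hβ hγ hx k).le)
    (hasSum_prabhakar hα hβ hγ hx hx1) (hasSum_mul_prabhakar_term hα hβ hγ hx hx1)
    (hasSum_mul_sub_one_mul_prabhakar_term hα hβ hγ hx hx1) (prabhakar_pos hα hβ hγ hx hx1)
  have hγx : 0 < γ * x := by positivity
  rw [div_mul_eq_mul_div, le_div_iff₀ hγx]
  refine le_of_mul_le_mul_left ?_ hγx
  linarith

/-- Functional upper bound for the Turánian difference on `(0,1)`:
`Δ_T(t) ≤ (1/(γ Γ₀ t^α (1-t^α)^{2γ+1})) [1/Γ₁ + t^α/(Γ₂(1-t^α))]`. -/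
theorem turanian_difference_upper_bound (α β γ t : ℝ) (hα : 0 < α) (hβ : 0 < β) (hγ : 0 < γ)
    (ht : t ∈ Set.Ioo (0 : ℝ) 1) :
    (prabhakar α (α + β) (γ + 1) (t ^ α)) ^ 2
        - prabhakar α β γ (t ^ α) * prabhakar α (2 * α + β) (γ + 2) (t ^ α)
      ≤ 1 / (γ * gammaInf α β 0 * t ^ α * (1 - t ^ α) ^ (2 * γ + 1))
          * (1 / gammaInf α β 1 + t ^ α / (gammaInf α β 2 * (1 - t ^ α))) := by
  have hx : 0 < t ^ α := Real.rpow_pos_of_pos ht.1 α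
  have hx1 : t ^ α < 1 := Real.rpow_lt_one ht.1.le ht.2 hα
  generalize t ^ α = x at hx hx1
  have h₀ := prabhakar_le hα hβ hγ hx hx1 0
  have h₁ := prabhakar_le (γ := γ + 1) hα hβ (by positivity) hx hx1 1
  have h₂ := prabhakar_le (γ := γ + 2) hα hβ (by positivity) hx hx1 2
  simp only [Nat.cast_zero, zero_mul, zero_add, Nat.cast_one, one_mul, Nat.cast_ofNat] at h₀ h₁ h₂
  have hp₀ := prabhakar_pos hα hβ hγ hx hx1
  have hp₁ := prabhakar_pos (β := α + β) (γ := γ + 1) hα (by positivity) (by positivity) hx hx1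
  have hp₂ := prabhakar_pos (β := 2 * α + β) (γ := γ + 2) hα (by positivity) (by positivity) hx hx1
  have hg₀ := gammaInf_pos hα hβ 0
  have hg₁ := gammaInf_pos hα hβ 1
  have hg₂ := gammaInf_pos hα hβ 2
  have hy : 0 < 1 - x := sub_pos.2 hx1
  have hyγ : 0 < (1 - x) ^ γ := Real.rpow_pos_of_pos hy γ
  refine (turanian_difference_le hα hβ hγ hx hx1).trans ?_
  calc _ ≤ 1 / (1 - x) ^ γ / gammaInf α β 0 / (γ * x) *
        (1 / (1 - x) ^ (γ + 1) / gammaInf α β 1 +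
          x * (1 / (1 - x) ^ (γ + 2) / gammaInf α β 2)) := by gcongr
    _ = _ := by
      rw [show 2 * γ + 1 = γ + (γ + 1) by ring, Real.rpow_add hy γ (γ + 1), Real.rpow_add hy γ 1,
        Real.rpow_add hy γ 2, Real.rpow_one, Real.rpow_two]
      field_simp
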